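/- arXiv:2412.15951 — 10 statements merged into one kernel-verified Lean document; each statement's English description precedes it below -/
import Mathlib

section
/- Let R be a nonzero unital commutative ring, G a group, B a unital R-algebra, and let π : G → B be a partial representation of G in B. Write ε_g := π(g)π(g⁻¹) for g ∈ G. Then: (i) π(g)π(g⁻¹)π(g) = π(g) and ε_g π(g) = π(g) for all g ∈ G; (ii) ε_g² = ε_g for all g ∈ G; (iii) ε_g ε_h = ε_h ε_g for all g, h ∈ G; (iv) π(g) ε_h = ε_{gh} π(g) for all g, h ∈ G; (v) π(g₁)π(g₂)⋯π(gₙ) = ε_{g₁} ε_{g₁g₂} ⋯ ε_{g₁g₂⋯g_{n−1}} π(g₁g₂⋯gₙ) for all n ≥ 1 and g₁, …, gₙ ∈ G. -/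
section PartialRepresentation

variable {G B : Type*} [Group G] [Monoid B] {π : G → B}

theorem partialRep_mul_inv_mul
    (hπ_left : ∀ g h : G, π g⁻¹ * π g * π h = π g⁻¹ * π (g * h)) (g h : G) :
    π g * π g⁻¹ * π h = π g * π (g⁻¹ * h) := by
  simpa using hπ_left g⁻¹ h

theorem partialRep_mul_idempotent
    (hπ_right : ∀ g h : G, π g * π h * π h⁻¹ = π (g * h) * π h⁻¹)
    (hπ_left : ∀ g h : G, π g⁻¹ * π g * π h = π g⁻¹ * π (g * h)) (g h : G) :
    π g * (π h * π h⁻¹) = π (g * h) * π (g * h)⁻¹ * π g := by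
  rw [partialRep_mul_inv_mul hπ_left, ← mul_assoc, hπ_right]
  simp

theorem partialRep_prod_ofFn
    (hπ_left : ∀ g h : G, π g⁻¹ * π g * π h = π g⁻¹ * π (g * h)) (n : ℕ) (g : Fin (n + 1) → G) :
    (List.ofFn fun i => π (g i)).prod =
      (List.ofFn fun i : Fin n =>
          π (((List.ofFn g).take (i.1 + 1)).prod) *
            π ((((List.ofFn g).take (i.1 + 1)).prod)⁻¹)).prod *
        π ((List.ofFn g).prod) := by
  induction n with
  | zero => simp
  | succ n ih =>
    have hg : List.ofFn g = List.ofFn (fun i => g (Fin.castSucc i)) ++ [g (Fin.last _)] := by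
      rw [List.ofFn_succ', List.concat_eq_append]
    have htake (k : ℕ) (hk : k ≤ n + 1) :
        (List.ofFn g).take k = (List.ofFn fun i => g (Fin.castSucc i)).take k := by
      rw [hg, List.take_append_of_le_length (by simpa using hk)]
    have hlast : (List.ofFn g).take (n + 1) = List.ofFn fun i => g (Fin.castSucc i) := by
      rw [htake _ le_rfl, List.take_of_length_le (by simp)]
    have hinit (i : Fin n) : (List.ofFn g).take (i.1 + 1) =
        (List.ofFn fun i => g (Fin.castSucc i)).take (i.1 + 1) :=
      htake _ (by omega)
    have hprod : (List.ofFn g).prod =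
        (List.ofFn fun i => g (Fin.castSucc i)).prod * g (Fin.last _) := by
      rw [hg, List.prod_append, List.prod_singleton]
    rw [List.ofFn_succ' fun i => π (g i), List.concat_eq_append, List.prod_append, ih,
      List.ofFn_succ' fun i : Fin (n + 1) => π _ * π _, List.concat_eq_append, List.prod_append]
    simp only [Fin.val_castSucc, Fin.val_last, hinit, hlast, List.prod_singleton]
    rw [hprod, mul_assoc, mul_assoc, partialRep_mul_inv_mul hπ_left, inv_mul_cancel_left]

end PartialRepresentation


/-- Lemma 2.7 (semsentido): basic identities satisfied by any partial representation
`π : G → B` of a group `G` in a unital `R`-algebra `B`, where `ε_g := π g * π g⁻¹`. -/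
theorem stmt_0 {R : Type*} [CommRing R] [Nontrivial R] {G : Type*} [Group G]
    {B : Type*} [Ring B] [Algebra R B] (π : G → B)
    (hπ_one : π 1 = 1)
    (hπ_right : ∀ g h : G, π g * π h * π h⁻¹ = π (g * h) * π h⁻¹)
    (hπ_left : ∀ g h : G, π g⁻¹ * π g * π h = π g⁻¹ * π (g * h)) :
    -- (i)
    (∀ g : G, π g * π g⁻¹ * π g = π g ∧ (π g * π g⁻¹) * π g = π g) ∧
    -- (ii)
    (∀ g : G, (π g * π g⁻¹) * (π g * π g⁻¹) = π g * π g⁻¹) ∧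
    -- (iii)
    (∀ g h : G, (π g * π g⁻¹) * (π h * π h⁻¹) = (π h * π h⁻¹) * (π g * π g⁻¹)) ∧
    -- (iv)
    (∀ g h : G, π g * (π h * π h⁻¹) = (π (g * h) * π (g * h)⁻¹) * π g) ∧
    -- (v)
    (∀ n : ℕ, 1 ≤ n → ∀ g : Fin n → G,
      (List.ofFn fun i => π (g i)).prod =
        (List.ofFn fun i : Fin (n - 1) =>
            π (((List.ofFn g).take (i.1 + 1)).prod) *
              π ((((List.ofFn g).take (i.1 + 1)).prod)⁻¹)).prod *
          π ((List.ofFn g).prod)) := by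
  have hcomm := partialRep_mul_idempotent hπ_right hπ_left
  have hreg (g : G) : π g * π g⁻¹ * π g = π g := by
    simp [partialRep_mul_inv_mul hπ_left, hπ_one]
  refine ⟨fun g => ⟨hreg g, hreg g⟩, fun g => ?_, fun g h => ?_, hcomm, fun n hn g => ?_⟩
  · rw [← mul_assoc, hreg]
  · rw [mul_assoc, hcomm g⁻¹ h, ← mul_assoc, hcomm g (g⁻¹ * h), mul_inv_cancel_left, mul_assoc]
  · obtain ⟨n, rfl⟩ := Nat.exists_eq_add_of_le' hn
    exact partialRep_prod_ofFn hπ_left n g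
end

section
/- Let R be a nonzero unital commutative ring, X a Stone space, and F ⊆ X a closed subset (with the subspace topology). Then for every locally constant function g : F → R with compact support there exists a locally constant function f : X → R with compact support such that f restricted to F equals g; that is, the restriction map Lc(X,R) → Lc(F,R) is a surjective R-algebra homomorphism. -/
/-- Gluing two locally constant functions along a clopen set gives a locally constant function. -/
theorem IsLocallyConstant.piecewise_of_isClopen {X Y : Type*} [TopologicalSpace X] {f g : X → Y}
    (hf : IsLocallyConstant f) (hg : IsLocallyConstant g) {V : Set X} (hV : IsClopen V)
    [∀ x, Decidable (x ∈ V)] : IsLocallyConstant (V.piecewise f g) := by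
  rw [IsLocallyConstant.iff_eventually_eq] at *
  intro x
  by_cases hx : x ∈ V
  · filter_upwards [hf x, hV.isOpen.mem_nhds hx] with y hy hyV
    simp [hx, hyV, hy]
  · filter_upwards [hg x, hV.compl.isOpen.mem_nhds hx] with y hy hyV
    rw [Set.piecewise_eq_of_notMem _ _ _ hx, Set.piecewise_eq_of_notMem _ _ _ hyV, hy]

/-- In a Hausdorff space with a basis of compact open sets, a locally constant function on a
subspace `F` can be extended over a compact open neighbourhood of any compact subset of `F`,
by a locally constant function vanishing outside that neighbourhood. -/
theorem IsLocallyConstant.exists_extension_near_isCompact {X Y : Type*} [TopologicalSpace X]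
    [T2Space X] [Zero Y]
    (hX : TopologicalSpace.IsTopologicalBasis {s : Set X | IsCompact s ∧ IsOpen s})
    {F : Set X} {g : F → Y} (hg : IsLocallyConstant g) {K : Set F} (hK : IsCompact K) :
    ∃ (f : X → Y) (V : Set X), IsLocallyConstant f ∧ IsCompact V ∧ IsOpen V ∧
      (∀ x ∈ K, (x : X) ∈ V) ∧ (∀ x : F, (x : X) ∈ V → f x = g x) ∧ ∀ x ∉ V, f x = 0 := by
  classical
  refine hK.induction_on ?_ (fun s t hst ht => ?_) (fun s t hs ht => ?_) fun x _ => ?_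
  · exact ⟨0, ∅, IsLocallyConstant.const 0, by simp⟩
  · obtain ⟨f, V, hf, hVc, hVo, hsub, heq, hzero⟩ := ht
    exact ⟨f, V, hf, hVc, hVo, fun x hx => hsub x (hst hx), heq, hzero⟩
  · obtain ⟨f, V, hf, hVc, hVo, hsub, heq, hzero⟩ := hs
    obtain ⟨f', V', hf', hVc', hVo', hsub', heq', hzero'⟩ := ht
    refine ⟨V.piecewise f f', V ∪ V', hf.piecewise_of_isClopen hf' ⟨hVc.isClosed, hVo⟩,
      hVc.union hVc', hVo.union hVo', fun x hx => hx.imp (hsub x) (hsub' x), fun x hx => ?_,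
      fun x hx => ?_⟩
    · by_cases h : (x : X) ∈ V
      · rw [Set.piecewise_eq_of_mem _ _ _ h, heq x h]
      · rw [Set.piecewise_eq_of_notMem _ _ _ h, heq' x (hx.resolve_left h)]
    · rw [Set.piecewise_eq_of_notMem _ _ _ fun h => hx (Or.inl h), hzero' x fun h => hx (Or.inr h)]
  · obtain ⟨U, hU, hUg⟩ :=
      (mem_nhds_subtype F x _).1 ((IsLocallyConstant.iff_eventually_eq g).1 hg x)
    obtain ⟨V, ⟨hVc, hVo⟩, hxV, hVU⟩ := hX.mem_nhds_iff.1 hU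
    refine ⟨Subtype.val ⁻¹' V, mem_nhdsWithin_of_mem_nhds
      ((hVo.preimage continuous_subtype_val).mem_nhds hxV), V.piecewise (fun _ => g x) 0, V,
      (IsLocallyConstant.const _).piecewise_of_isClopen (IsLocallyConstant.const 0)
        ⟨hVc.isClosed, hVo⟩, hVc, hVo, fun y hy => hy, fun y hy => ?_, fun y hy => ?_⟩
    · rw [Set.piecewise_eq_of_mem _ _ _ hy]
      exact (hUg (hVU hy)).symm
    · rw [Set.piecewise_eq_of_notMem _ _ _ hy, Pi.zero_apply]

/-- Lemma 3.2: for a Stone space `X` (Hausdorff with a basis of compact open sets) and a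
closed subset `F`, every locally constant compactly supported function `g : F → R` extends
to a locally constant compactly supported function `f : X → R`; i.e. the restriction map
`Lc(X,R) → Lc(F,R)` is a surjective `R`-algebra homomorphism. -/
theorem stmt_1 {R : Type*} [CommRing R] [Nontrivial R]
    {X : Type*} [TopologicalSpace X] [T2Space X]
    (hX : TopologicalSpace.IsTopologicalBasis {s : Set X | IsCompact s ∧ IsOpen s})
    (F : Set X) (hF : IsClosed F)
    (g : F → R) (hg : IsLocallyConstant g) (hgc : HasCompactSupport g) :
    ∃ f : X → R, IsLocallyConstant f ∧ HasCompactSupport f ∧ ∀ x : F, f x = g x := by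
  obtain ⟨f, V, hf, hVc, -, hsub, heq, hzero⟩ := hg.exists_extension_near_isCompact hX hgc
  refine ⟨f, hf, HasCompactSupport.intro hVc hzero, fun x => ?_⟩
  by_cases hx : (x : X) ∈ V
  · exact heq x hx
  · rw [hzero x hx, image_eq_zero_of_notMem_tsupport fun h => hx (hsub x h)]
end

section
/- Let R be a nonzero unital commutative ring, X a Stone space, and J an ideal of Lc(X,R). Define F := {x ∈ X : f(x) = 0 for all f ∈ J} and I(F) := {f ∈ Lc(X,R) : f(x) = 0 for all x ∈ F}. Then I(F) = J if and only if for every x ∈ X \ F there exists f ∈ J with f(x) = 1. -/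
/-- The indicator function of a clopen set is locally constant. -/
theorem IsClopen.isLocallyConstant_indicator_one {X R : Type*} [TopologicalSpace X] [Zero R] [One R]
    {U : Set X} (hU : IsClopen U) : IsLocallyConstant (U.indicator (1 : X → R)) := by
  rw [IsLocallyConstant.iff_eventually_eq]
  intro x
  by_cases hx : x ∈ U
  · filter_upwards [hU.isOpen.mem_nhds hx] with y hy
    simp [hx, hy]
  · filter_upwards [hU.compl.isOpen.mem_nhds hx] with y hy
    simp [hx, Set.indicator_of_notMem hy]

/-- A set `J` of locally constant functions that is closed under sums, scalar multiples and products
and takes the value `1` at each point of a compact set `K` contains a function that is constantly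
`1` on `K`. -/
theorem IsCompact.exists_mem_eqOn_one {X R : Type*} [TopologicalSpace X] [CommRing R]
    {K : Set X} (hK : IsCompact K) {J : Set (X → R)}
    (hlc : ∀ f ∈ J, IsLocallyConstant f) (hzero : (0 : X → R) ∈ J)
    (hadd : ∀ f ∈ J, ∀ g ∈ J, f + g ∈ J) (hsmul : ∀ r : R, ∀ f ∈ J, r • f ∈ J)
    (hmul : ∀ f ∈ J, ∀ g ∈ J, f * g ∈ J) (h : ∀ x ∈ K, ∃ f ∈ J, f x = 1) :
    ∃ e ∈ J, ∀ x ∈ K, e x = 1 := by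
  refine hK.induction_on (p := fun S => ∃ e ∈ J, ∀ x ∈ S, e x = 1) ⟨0, hzero, by simp⟩ ?_ ?_ ?_
  · rintro S T hST ⟨e, he, h1⟩
    exact ⟨e, he, fun x hx => h1 x (hST hx)⟩
  · rintro S T ⟨e, he, h1⟩ ⟨e', he', h1'⟩
    refine ⟨e + e' + (-1 : R) • (e * e'), hadd _ (hadd _ he _ he') _ (hsmul _ _ (hmul _ he _ he')),
      ?_⟩
    rintro x (hx | hx)
    · simp [h1 x hx]
    · simp [h1' x hx]
  · intro x hx
    obtain ⟨g, hg, hgx⟩ := h x hx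
    exact ⟨g ⁻¹' {1}, mem_nhdsWithin_of_mem_nhds (((hlc g hg).isOpen_fiber 1).mem_nhds hgx),
      g, hg, fun y hy => hy⟩

/-- Lemma 3.3: for a Stone space `X` and an ideal `J` of `Lc(X,R)` (locally constant
functions with compact support), letting `F = {x : ∀ f ∈ J, f x = 0}` and
`I(F) = {f ∈ Lc(X,R) : f|_F = 0}`, one has `I(F) = J` iff for every `x ∉ F` there is
`f ∈ J` with `f x = 1`. -/
theorem stmt_2 {R : Type*} [CommRing R] [Nontrivial R]
    {X : Type*} [TopologicalSpace X] [T2Space X]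
    (hX : TopologicalSpace.IsTopologicalBasis {s : Set X | IsCompact s ∧ IsOpen s})
    (J : Set (X → R))
    (hJLc : ∀ f ∈ J, IsLocallyConstant f ∧ HasCompactSupport f)
    (hJzero : (0 : X → R) ∈ J)
    (hJadd : ∀ f ∈ J, ∀ g ∈ J, f + g ∈ J)
    (hJsmul : ∀ r : R, ∀ f ∈ J, r • f ∈ J)
    (hJmul : ∀ g : X → R, IsLocallyConstant g → HasCompactSupport g → ∀ f ∈ J, g * f ∈ J) :
    {f : X → R | (IsLocallyConstant f ∧ HasCompactSupport f) ∧
        ∀ x : X, (∀ j ∈ J, j x = 0) → f x = 0} = J ↔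
      ∀ x : X, ¬ (∀ j ∈ J, j x = 0) → ∃ f ∈ J, f x = 1 := by
  constructor
  · intro hJ x hx
    push Not at hx
    obtain ⟨j, hj, hjx⟩ := hx
    obtain ⟨U, ⟨hUc, hUo⟩, hxU, hUj⟩ :=
      hX.exists_subset_of_mem_open (u := j ⁻¹' {0}ᶜ) hjx ((hJLc j hj).1 _)
    have hU : IsClopen U := ⟨hUc.isClosed, hUo⟩
    refine ⟨U.indicator 1, ?_, by simp [hxU]⟩
    rw [← hJ]
    refine ⟨⟨hU.isLocallyConstant_indicator_one,
      HasCompactSupport.intro hUc fun y hy => Set.indicator_of_notMem hy _⟩, fun y hy => ?_⟩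
    exact Set.indicator_of_notMem (fun hyU => hUj hyU (hy j hj)) _
  · intro h
    refine Set.Subset.antisymm ?_ fun f hf => ⟨hJLc f hf, fun x hx => hx f hf⟩
    rintro f ⟨⟨hf, hfc⟩, hfF⟩
    have hsupp : tsupport f = Function.support f :=
      (hf.isClopen_fiber 0).compl.isClosed.closure_eq
    obtain ⟨e, he, h1⟩ := IsCompact.exists_mem_eqOn_one hfc (fun g hg => (hJLc g hg).1) hJzero hJadd
      hJsmul (fun g hg k hk => hJmul g (hJLc g hg).1 (hJLc g hg).2 k hk)
      (fun x hx => h x fun hxF => (hsupp ▸ hx : x ∈ Function.support f) (hfF x hxF))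
    have hfe : f * e = f := by
      ext x
      by_cases hx : x ∈ tsupport f
      · simp [h1 x hx]
      · simp [image_eq_zero_of_notMem_tsupport hx]
    exact hfe ▸ hJmul f hf hfc e he
end

section
/- Let R be a nonzero unital commutative ring, X a Stone space, and J an ideal of Lc(X,R). Define F := {x ∈ X : f(x) = 0 for all f ∈ J}, a closed subset of X. Suppose that for every x ∈ X \ F there exists f ∈ J with f(x) = 1. Then the quotient algebra Lc(X,R)/J is isomorphic as an R-algebra to Lc(F,R), via the map induced by restriction of functions to F. -/
lemma IsLocallyConstant.ite_mem_of_isClopen {X Y : Type*} [TopologicalSpace X] {W : Set X}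
    (hW : IsClopen W) [DecidablePred (· ∈ W)] {f g : X → Y} (hf : IsLocallyConstant f)
    (hg : IsLocallyConstant g) : IsLocallyConstant (fun x => if x ∈ W then f x else g x) := by
  rw [IsLocallyConstant.iff_eventually_eq] at *
  intro x
  by_cases hx : x ∈ W
  · filter_upwards [hf x, hW.isOpen.mem_nhds hx] with y hy hyW
    simp [hx, hyW, hy]
  · filter_upwards [hg x, hW.compl.isOpen.mem_nhds hx] with y hy hyW
    have hyW' : y ∉ W := hyW
    simp [hx, hyW', hy]

/-- In a Stone space, a locally constant compactly supported function on a subset extends to a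
locally constant compactly supported function on the whole space. -/
lemma exists_isLocallyConstant_extension {R X : Type*} [Zero R] [TopologicalSpace X] [T2Space X]
    (hX : TopologicalSpace.IsTopologicalBasis {s : Set X | IsCompact s ∧ IsOpen s})
    {F : Set X} {g : F → R} (hg : IsLocallyConstant g) (hgc : HasCompactSupport g) :
    ∃ f : X → R, IsLocallyConstant f ∧ HasCompactSupport f ∧ ∀ x : F, f x = g x := by
  classical
  have key : ∃ (W : Set X) (f : X → R), IsCompact W ∧ IsOpen W ∧
      (Subtype.val '' tsupport g) ⊆ W ∧ IsLocallyConstant f ∧ (∀ x ∉ W, f x = 0) ∧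
      ∀ x : F, (x : X) ∈ W → f x = g x := by
    have hS : IsCompact (Subtype.val '' tsupport g) :=
      IsCompact.image hgc continuous_subtype_val
    refine hS.induction_on (p := fun S => ∃ (W : Set X) (f : X → R), IsCompact W ∧ IsOpen W ∧
      S ⊆ W ∧ IsLocallyConstant f ∧ (∀ x ∉ W, f x = 0) ∧
      ∀ x : F, (x : X) ∈ W → f x = g x) ?_ ?_ ?_ ?_
    · exact ⟨∅, fun _ => 0, isCompact_empty, isOpen_empty, subset_rfl,
        IsLocallyConstant.const 0, by simp, by simp⟩
    · rintro s t hst ⟨W, f, h1, h2, h3, h⟩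
      exact ⟨W, f, h1, h2, hst.trans h3, h⟩
    · rintro s t ⟨W₁, f₁, hc₁, ho₁, hs₁, hl₁, hz₁, he₁⟩ ⟨W₂, f₂, hc₂, ho₂, hs₂, hl₂, hz₂, he₂⟩
      refine ⟨W₁ ∪ W₂, fun x => if x ∈ W₁ then f₁ x else f₂ x, hc₁.union hc₂, ho₁.union ho₂,
        Set.union_subset_union hs₁ hs₂, hl₁.ite_mem_of_isClopen ⟨hc₁.isClosed, ho₁⟩ hl₂, ?_, ?_⟩
      · intro x hx
        rw [Set.mem_union, not_or] at hx
        simp [hx.1, hz₂ x hx.2]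
      · intro x hx
        by_cases h : (x : X) ∈ W₁
        · simp [h, he₁ x h]
        · simp [h, he₂ x (hx.resolve_left h)]
    · rintro _ ⟨x, -, rfl⟩
      have hx := (IsLocallyConstant.iff_eventually_eq g).1 hg x
      rw [nhds_subtype_eq_comap, Filter.eventually_comap] at hx
      obtain ⟨W, ⟨hc, ho⟩, hxW, hWU⟩ := hX.mem_nhds_iff.1 hx
      refine ⟨W, mem_nhdsWithin_of_mem_nhds (ho.mem_nhds hxW), W,
        fun y => if y ∈ W then g x else 0, hc, ho, subset_rfl,
        (IsLocallyConstant.const (g x)).ite_mem_of_isClopen ⟨hc.isClosed, ho⟩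
          (IsLocallyConstant.const 0), ?_, ?_⟩
      · intro y hy
        simp [hy]
      · intro y hy
        simp [hy, hWU hy y rfl]
  obtain ⟨W, f, hc, -, hs, hl, hz, he⟩ := key
  refine ⟨f, hl, HasCompactSupport.intro hc hz, fun x => ?_⟩
  by_cases hx : (x : X) ∈ W
  · exact he x hx
  · rw [hz x hx, image_eq_zero_of_notMem_tsupport fun h => hx (hs ⟨x, h, rfl⟩)]

/-- If a set `J` of locally constant functions, closed under the ring operations, has at every
point of a compact set `K` an element with value `1`, then some element of `J` is `1` on `K`. -/
lemma exists_mem_eq_one_on_isCompact {R X : Type*} [CommRing R] [TopologicalSpace X]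
    {J : Set (X → R)} (hJ : ∀ f ∈ J, IsLocallyConstant f) (hzero : (0 : X → R) ∈ J)
    (hadd : ∀ f ∈ J, ∀ g ∈ J, f + g ∈ J) (hsmul : ∀ r : R, ∀ f ∈ J, r • f ∈ J)
    (hmul : ∀ f ∈ J, ∀ g ∈ J, f * g ∈ J) {K : Set X} (hK : IsCompact K)
    (hone : ∀ x ∈ K, ∃ f ∈ J, f x = 1) : ∃ e ∈ J, ∀ x ∈ K, e x = 1 := by
  refine hK.induction_on (p := fun S => ∃ e ∈ J, ∀ x ∈ S, e x = 1) ?_ ?_ ?_ ?_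
  · exact ⟨0, hzero, by simp⟩
  · rintro s t hst ⟨e, he, h⟩
    exact ⟨e, he, fun x hx => h x (hst hx)⟩
  · rintro s t ⟨a, ha, hs⟩ ⟨b, hb, ht⟩
    refine ⟨a + b + (-1 : R) • (a * b), hadd _ (hadd _ ha _ hb) _ (hsmul _ _ (hmul _ ha _ hb)), ?_⟩
    rintro x (hx | hx)
    · simp [hs x hx]
    · simp [ht x hx]
  · intro x hx
    obtain ⟨f, hf, hfx⟩ := hone x hx
    refine ⟨{y | f y = f x}, mem_nhdsWithin_of_mem_nhds
      ((IsLocallyConstant.iff_eventually_eq f).1 (hJ f hf) x), f, hf, fun y hy => ?_⟩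
    rw [← hfx]
    exact hy


/-- Proposition 3.4: for a Stone space `X` and an ideal `J` of `Lc(X,R)` such that every
`x ∉ F := {x : ∀ f ∈ J, f x = 0}` admits `f ∈ J` with `f x = 1`, the quotient
`Lc(X,R)/J` is isomorphic to `Lc(F,R)` via the map induced by restriction to `F`;
equivalently, the restriction map `Lc(X,R) → Lc(F,R)` is surjective and its kernel is
exactly `J`. -/
theorem stmt_3 {R : Type*} [CommRing R] [Nontrivial R]
    {X : Type*} [TopologicalSpace X] [T2Space X]
    (hX : TopologicalSpace.IsTopologicalBasis {s : Set X | IsCompact s ∧ IsOpen s})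
    (J : Set (X → R))
    (hJLc : ∀ f ∈ J, IsLocallyConstant f ∧ HasCompactSupport f)
    (hJzero : (0 : X → R) ∈ J)
    (hJadd : ∀ f ∈ J, ∀ g ∈ J, f + g ∈ J)
    (hJsmul : ∀ r : R, ∀ f ∈ J, r • f ∈ J)
    (hJmul : ∀ g : X → R, IsLocallyConstant g → HasCompactSupport g → ∀ f ∈ J, g * f ∈ J)
    (hreg : ∀ x : X, ¬ (∀ j ∈ J, j x = 0) → ∃ f ∈ J, f x = 1) :
    -- `F` is the common zero set of `J`
    (∀ g : ({x : X | ∀ j ∈ J, j x = 0} : Set X) → R, IsLocallyConstant g →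
      HasCompactSupport g →
      ∃ f : X → R, IsLocallyConstant f ∧ HasCompactSupport f ∧
        ∀ x : ({x : X | ∀ j ∈ J, j x = 0} : Set X), f x = g x) ∧
    (∀ f : X → R, IsLocallyConstant f → HasCompactSupport f →
      ((∀ x ∈ ({x : X | ∀ j ∈ J, j x = 0} : Set X), f x = 0) ↔ f ∈ J)) := by
  refine ⟨fun g hg hgc => exists_isLocallyConstant_extension hX hg hgc, fun f hf hfc =>
    ⟨fun hfF => ?_, fun hfJ x hx => hx f hfJ⟩⟩
  have hclosed : IsClosed (Function.support f) := (hf.isClopen_fiber 0).compl.isClosed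
  have hcomp : IsCompact (Function.support f) := by
    rw [← hclosed.closure_eq]
    exact hfc
  obtain ⟨e, he, he1⟩ := exists_mem_eq_one_on_isCompact (fun f hf => (hJLc f hf).1) hJzero hJadd
    hJsmul (fun f hf g hg => hJmul f (hJLc f hf).1 (hJLc f hf).2 g hg) hcomp
    fun x hx => hreg x fun h => hx (hfF x h)
  have hfe : f * e = f := by
    funext x
    by_cases hx : f x = 0
    · simp [hx]
    · simp [he1 x hx]
  rw [← hfe]
  exact hJmul f hf hfc e he
end

section
/- Let R be a field, X a Stone space, and J any ideal of Lc(X,R). Define F := {x ∈ X : f(x) = 0 for all f ∈ J}, a closed subset of X. Then the quotient algebra Lc(X,R)/J is isomorphic as an R-algebra to Lc(F,R), via the map induced by restriction of functions to F. -/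
open Set

theorem IsLocallyConstant.indicator_of_isClopen {X R : Type*} [TopologicalSpace X] [Zero R]
    {f : X → R} (hf : IsLocallyConstant f) {U : Set X} (hU : IsClopen U) :
    IsLocallyConstant (U.indicator f) :=
  (LocallyConstant.indicator ⟨f, hf⟩ hU).isLocallyConstant

theorem HasCompactSupport.indicator_of_isCompact {X R : Type*} [TopologicalSpace X] [R1Space X]
    [Zero R] (f : X → R) {U : Set X} (hU : IsCompact U) : HasCompactSupport (U.indicator f) :=
  HasCompactSupport.intro hU fun _ hx => indicator_of_notMem hx f

/-- Near any compact subset of a subspace `F`, a locally constant function on `F` extends to a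
locally constant function on the ambient space. -/
theorem IsLocallyConstant.exists_extension_on_compact {X R : Type*} [TopologicalSpace X]
    [T2Space X] [Zero R]
    (hX : TopologicalSpace.IsTopologicalBasis {s : Set X | IsCompact s ∧ IsOpen s})
    {F : Set X} {g : F → R} (hg : IsLocallyConstant g) {K : Set F} (hK : IsCompact K) :
    ∃ U : Set X, IsCompact U ∧ IsOpen U ∧ (∀ x ∈ K, (x : X) ∈ U) ∧
      ∃ f : X → R, IsLocallyConstant f ∧ ∀ x : F, (x : X) ∈ U → f x = g x := by
  classical
  refine hK.induction_on (p := fun K => ∃ U : Set X, IsCompact U ∧ IsOpen U ∧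
    (∀ x ∈ K, (x : X) ∈ U) ∧
      ∃ f : X → R, IsLocallyConstant f ∧ ∀ x : F, (x : X) ∈ U → f x = g x) ?_ ?_ ?_ ?_
  · exact ⟨∅, isCompact_empty, isOpen_empty, by simp, 0, .const 0, by simp⟩
  · rintro s t hst ⟨U, hUc, hUo, hU, h⟩
    exact ⟨U, hUc, hUo, fun x hx => hU x (hst hx), h⟩
  · rintro s t ⟨U, hUc, hUo, hsU, f, hf, hfg⟩ ⟨V, hVc, hVo, htV, f', hf', hfg'⟩
    have hU : IsClopen U := ⟨hUc.isClosed, hUo⟩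
    refine ⟨U ∪ V, hUc.union hVc, hUo.union hVo, fun x hx => hx.imp (hsU x) (htV x),
      U.piecewise f f', ?_, ?_⟩
    · rw [IsLocallyConstant.iff_eventually_eq] at hf hf' ⊢
      intro x
      by_cases hx : x ∈ U
      · filter_upwards [hf x, hUo.mem_nhds hx] with y hy hyU
        simp [hx, hyU, hy]
      · filter_upwards [hf' x, hU.compl.isOpen.mem_nhds hx] with y hy hyU
        have hyU : y ∉ U := hyU
        simp [hx, hyU, hy]
    · intro x hx
      by_cases hxU : (x : X) ∈ U
      · simpa [hxU] using hfg x hxU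
      · simpa [hxU] using hfg' x (hx.resolve_left hxU)
  · intro x hx
    have hopen : IsOpen (g ⁻¹' {g x}) := hg.isOpen_fiber (g x)
    obtain ⟨V, hVo, hV⟩ := isOpen_induced_iff.1 hopen
    have hxV : (x : X) ∈ V := by
      change x ∈ Subtype.val ⁻¹' V
      rw [hV]; rfl
    obtain ⟨U, ⟨hUc, hUo⟩, hxU, hUV⟩ := hX.exists_subset_of_mem_open hxV hVo
    refine ⟨Subtype.val ⁻¹' U,
      mem_nhdsWithin_of_mem_nhds ((hUo.preimage continuous_subtype_val).mem_nhds hxU),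
      U, hUc, hUo, fun y hy => hy, fun _ => g x, .const _, fun y hy => ?_⟩
    have : y ∈ g ⁻¹' {g x} := by
      rw [← hV]; exact hUV hy
    exact this.symm

/-- A compact set disjoint from the common zero set of an ideal `J` of locally constant functions
with compact support lies in a compact open set whose characteristic function is in `J`. -/
theorem exists_indicator_mem_of_isCompact {R : Type*} [Field R]
    {X : Type*} [TopologicalSpace X] [T2Space X]
    (hX : TopologicalSpace.IsTopologicalBasis {s : Set X | IsCompact s ∧ IsOpen s})
    {J : Set (X → R)} (hJLc : ∀ f ∈ J, IsLocallyConstant f) (hJzero : (0 : X → R) ∈ J)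
    (hJadd : ∀ f ∈ J, ∀ g ∈ J, f + g ∈ J) (hJsmul : ∀ r : R, ∀ f ∈ J, r • f ∈ J)
    (hJmul : ∀ g : X → R, IsLocallyConstant g → HasCompactSupport g → ∀ f ∈ J, g * f ∈ J)
    {K : Set X} (hK : IsCompact K) (hKJ : ∀ x ∈ K, ∃ j ∈ J, j x ≠ 0) :
    ∃ U : Set X, IsCompact U ∧ IsOpen U ∧ K ⊆ U ∧ U.indicator (1 : X → R) ∈ J := by
  have hLc {U : Set X} (hUc : IsCompact U) (hUo : IsOpen U) :
      IsLocallyConstant (U.indicator (1 : X → R)) :=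
    (IsLocallyConstant.const 1).indicator_of_isClopen ⟨hUc.isClosed, hUo⟩
  refine hK.induction_on (p := fun s => ∃ U : Set X, IsCompact U ∧ IsOpen U ∧ s ⊆ U ∧
    U.indicator (1 : X → R) ∈ J) ?_ ?_ ?_ ?_
  · exact ⟨∅, isCompact_empty, isOpen_empty, subset_rfl, by rwa [indicator_empty']⟩
  · rintro s t hst ⟨U, hUc, hUo, hU, h⟩
    exact ⟨U, hUc, hUo, hst.trans hU, h⟩
  · rintro s t ⟨U, hUc, hUo, hsU, hUJ⟩ ⟨V, hVc, hVo, htV, hVJ⟩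
    refine ⟨U ∪ V, hUc.union hVc, hUo.union hVo, union_subset_union hsU htV, ?_⟩
    convert hJadd _ (hJadd _ hUJ _ hVJ) _ (hJsmul (-1) _
      (hJmul _ (hLc hUc hUo) (.indicator_of_isCompact _ hUc) _ hVJ)) using 1
    ext x
    by_cases hxU : x ∈ U <;> by_cases hxV : x ∈ V <;> simp [hxU, hxV]
  · intro x hx
    obtain ⟨j, hj, hjx⟩ := hKJ x hx
    obtain ⟨U, ⟨hUc, hUo⟩, hxU, hUj⟩ := hX.exists_subset_of_mem_open
      (show x ∈ j ⁻¹' {j x} from rfl) ((hJLc j hj).isOpen_fiber (j x))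
    refine ⟨U, mem_nhdsWithin_of_mem_nhds (hUo.mem_nhds hxU), U, hUc, hUo, subset_rfl, ?_⟩
    convert hJsmul (j x)⁻¹ _ (hJmul _ (hLc hUc hUo) (.indicator_of_isCompact _ hUc) _ hj) using 1
    ext y
    by_cases hy : y ∈ U
    · have hyx : j y = j x := hUj hy
      simp [hy, hyx, hjx]
    · simp [hy]


/-- Remark 3.5: when `R` is a field, for any ideal `J` of `Lc(X,R)` over a Stone space `X`,
the quotient `Lc(X,R)/J` is isomorphic to `Lc(F,R)` where `F` is the common zero set of
`J`, via the map induced by restriction to `F`; equivalently, the restriction map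
`Lc(X,R) → Lc(F,R)` is surjective and its kernel is exactly `J`. -/
theorem stmt_4 {R : Type*} [Field R]
    {X : Type*} [TopologicalSpace X] [T2Space X]
    (hX : TopologicalSpace.IsTopologicalBasis {s : Set X | IsCompact s ∧ IsOpen s})
    (J : Set (X → R))
    (hJLc : ∀ f ∈ J, IsLocallyConstant f ∧ HasCompactSupport f)
    (hJzero : (0 : X → R) ∈ J)
    (hJadd : ∀ f ∈ J, ∀ g ∈ J, f + g ∈ J)
    (hJsmul : ∀ r : R, ∀ f ∈ J, r • f ∈ J)
    (hJmul : ∀ g : X → R, IsLocallyConstant g → HasCompactSupport g → ∀ f ∈ J, g * f ∈ J) :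
    (∀ g : ({x : X | ∀ j ∈ J, j x = 0} : Set X) → R, IsLocallyConstant g →
      HasCompactSupport g →
      ∃ f : X → R, IsLocallyConstant f ∧ HasCompactSupport f ∧
        ∀ x : ({x : X | ∀ j ∈ J, j x = 0} : Set X), f x = g x) ∧
    (∀ f : X → R, IsLocallyConstant f → HasCompactSupport f →
      ((∀ x ∈ ({x : X | ∀ j ∈ J, j x = 0} : Set X), f x = 0) ↔ f ∈ J)) := by
  refine ⟨fun g hg hgc => ?_, fun f hf hfc => ⟨fun hfF => ?_, fun hfJ x hx => hx f hfJ⟩⟩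
  · obtain ⟨U, hUc, hUo, hU, f, hf, hfg⟩ := hg.exists_extension_on_compact hX hgc
    refine ⟨U.indicator f, hf.indicator_of_isClopen ⟨hUc.isClosed, hUo⟩,
      .indicator_of_isCompact f hUc, fun x => ?_⟩
    by_cases hx : (x : X) ∈ U
    · simpa [hx] using hfg x hx
    · rw [Set.indicator_of_notMem hx, image_eq_zero_of_notMem_tsupport fun h => hx (hU x h)]
  · have hsupp : tsupport f = Function.support f :=
      IsClosed.closure_eq ⟨hf {0}ᶜᶜ⟩
    obtain ⟨U, -, -, hU, hUJ⟩ := exists_indicator_mem_of_isCompact hX (fun j hj => (hJLc j hj).1)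
      hJzero hJadd hJsmul hJmul hfc fun x hx => by
        rw [hsupp] at hx
        by_contra! h
        exact hx (hfF x h)
    convert hJmul f hf hfc _ hUJ using 1
    ext x
    by_cases hx : x ∈ U
    · simp [hx]
    · simp [hx, image_eq_zero_of_notMem_tsupport fun h => hx (hU h)]
end

section
/- Let R be an indecomposable commutative unital ring, let X and Y be compact Stone spaces, and let φ : Lc(X,R) → Lc(Y,R) be a unital R-algebra homomorphism. Then there exists a continuous function h : Y → X such that φ(f) = f ∘ h for all f ∈ Lc(X,R). -/
/-- An algebra homomorphism from locally constant functions on a compact space to an indecomposable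
ring is evaluation at a point. -/
theorem LocallyConstant.exists_forall_algHom_eq_apply {R X : Type*} [CommRing R] [Nontrivial R]
    (hR : ∀ e : R, e * e = e → e = 0 ∨ e = 1) [TopologicalSpace X] [CompactSpace X]
    (ψ : LocallyConstant X R →ₐ[R] R) : ∃ x : X, ∀ f : LocallyConstant X R, ψ f = f x := by
  by_contra! hψ
  choose f hf using hψ
  have hU (x : X) : IsClopen (f x ⁻¹' {f x x}) := (f x).isLocallyConstant.isClopen_fiber (f x x)
  have hzero (x : X) : ψ (charFn R (hU x)) = 0 := by
    have hidem : charFn R (hU x) * charFn R (hU x) = charFn R (hU x) := by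
      ext y
      by_cases hy : f x y = f x x <;> simp [coe_charFn, Set.indicator, hy]
    refine (hR _ (by rw [← map_mul, hidem])).resolve_right fun hone => hf x ?_
    have hmul : charFn R (hU x) * f x = f x x • charFn R (hU x) := by
      ext y
      by_cases hy : f x y = f x x <;> simp [coe_charFn, Set.indicator, hy]
    simpa [hone] using congrArg ψ hmul
  obtain ⟨t, ht⟩ := CompactSpace.elim_nhds_subcover (fun x => f x ⁻¹' {f x x})
    fun x => (hU x).isOpen.mem_nhds rfl
  have hprod : ∏ x ∈ t, (1 - charFn R (hU x)) = 0 := by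
    ext y
    obtain ⟨x, hx, hy⟩ : ∃ x ∈ t, y ∈ f x ⁻¹' {f x x} := by
      simpa using ht.ge (Set.mem_univ y)
    change evalRingHom y (∏ x ∈ t, (1 - charFn R (hU x))) = 0
    rw [map_prod]
    refine Finset.prod_eq_zero hx ?_
    rw [map_sub, map_one, evalRingHom_apply, (charFn_eq_one R y (hU x)).2 hy, sub_self]
  simpa [hzero] using congrArg ψ hprod

/-- Part of Lemma 3.7: if `R` is an indecomposable commutative unital ring and `X`, `Y`
are compact Stone spaces, then every unital `R`-algebra homomorphism
`φ : Lc(X,R) → Lc(Y,R)` is induced by composition with a continuous map `h : Y → X`. -/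
theorem stmt_5 {R : Type*} [CommRing R] [Nontrivial R]
    (hR : ∀ e : R, e * e = e → e = 0 ∨ e = 1)
    {X Y : Type*} [TopologicalSpace X] [CompactSpace X] [T2Space X]
    [TotallyDisconnectedSpace X]
    [TopologicalSpace Y] [CompactSpace Y] [T2Space Y] [TotallyDisconnectedSpace Y]
    (φ : LocallyConstant X R →ₐ[R] LocallyConstant Y R) :
    ∃ h : Y → X, Continuous h ∧ ∀ (f : LocallyConstant X R) (y : Y), φ f y = f (h y) := by
  choose h hh using fun y : Y => LocallyConstant.exists_forall_algHom_eq_apply hR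
    ((LocallyConstant.evalₐ R y).comp φ)
  have hφ (f : LocallyConstant X R) (y : Y) : φ f y = f (h y) := hh y f
  refine ⟨h, isTopologicalBasis_isClopen.continuous_iff.2 fun U hU => ?_, hφ⟩
  have hpre : h ⁻¹' U = φ (LocallyConstant.charFn R hU) ⁻¹' {1} := by
    ext y
    simp [hφ, LocallyConstant.charFn_eq_one]
  rw [hpre]
  exact (φ _).isLocallyConstant.isOpen_fiber 1
end

section
/- Let R be an indecomposable commutative unital ring, let X and Y be compact Stone spaces, and let φ : Lc(X,R) → Lc(Y,R) be a unital R-algebra homomorphism. Define F := {x ∈ X : f(x) = 0 for all f ∈ ker(φ)}. Then for every x ∈ X \ F there exists f ∈ ker(φ) such that f(x) = 1. -/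
/-- Lemma 3.7, first part: with `R` indecomposable, `X`, `Y` compact Stone spaces and
`φ : Lc(X,R) → Lc(Y,R)` a unital `R`-algebra homomorphism, setting
`F = {x : f x = 0 for all f ∈ ker φ}`, every `x ∉ F` admits `f ∈ ker φ` with `f x = 1`. -/
theorem stmt_6 {R : Type*} [CommRing R] [Nontrivial R]
    (hR : ∀ e : R, e * e = e → e = 0 ∨ e = 1)
    {X Y : Type*} [TopologicalSpace X] [CompactSpace X] [T2Space X]
    [TotallyDisconnectedSpace X]
    [TopologicalSpace Y] [CompactSpace Y] [T2Space Y] [TotallyDisconnectedSpace Y]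
    (φ : LocallyConstant X R →ₐ[R] LocallyConstant Y R) (x : X)
    (hx : x ∉ {x : X | ∀ f : LocallyConstant X R, φ f = 0 → f x = 0}) :
    ∃ f : LocallyConstant X R, φ f = 0 ∧ f x = 1 := by
  simp only [Set.mem_ofPred_eq, not_forall] at hx
  obtain ⟨f, hf, hfx⟩ := hx
  have hU : IsClopen (f ⁻¹' {f x}) := f.isLocallyConstant.isClopen_fiber (f x)
  set e : LocallyConstant X R := LocallyConstant.charFn R hU with he
  have e_idem : e * e = e := by
    ext z
    by_cases hz : f z = f x <;> simp [he, LocallyConstant.coe_charFn, Set.indicator, hz]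
  have mul_e : f * e = f x • e := by
    ext z
    by_cases hz : f z = f x <;> simp [he, LocallyConstant.coe_charFn, Set.indicator, hz]
  have smul_φe : f x • φ e = 0 := by
    rw [← map_smul, ← mul_e, map_mul, hf, zero_mul]
  refine ⟨e, ?_, (LocallyConstant.charFn_eq_one R x hU).2 rfl⟩
  ext y
  have φe_idem : φ e y * φ e y = φ e y := by
    rw [← LocallyConstant.mul_apply, ← map_mul, e_idem]
  refine (hR _ φe_idem).resolve_right fun h => hfx ?_
  simpa [h] using DFunLike.congr_fun smul_φe y
end

section
/- Let R be an indecomposable commutative unital ring, let X and Y be compact Stone spaces, and let φ : Lc(X,R) → Lc(Y,R) be a surjective unital R-algebra homomorphism. Define F := {x ∈ X : f(x) = 0 for all f ∈ ker(φ)}. Then F, with the subspace topology inherited from X, is homeomorphic to Y. -/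
namespace LocallyConstant

/-- Over an indecomposable ring, every character of the algebra of locally constant functions on
a compact space is the evaluation at some point. -/
theorem exists_eq_eval {R : Type*} [CommRing R] [Nontrivial R]
    (hR : ∀ e : R, e * e = e → e = 0 ∨ e = 1)
    {X : Type*} [TopologicalSpace X] [CompactSpace X] (χ : LocallyConstant X R →ₐ[R] R) :
    ∃ x : X, ∀ f : LocallyConstant X R, χ f = f x := by
  by_contra! h
  have key : ∃ e : LocallyConstant X R, χ e = 0 ∧ ∀ x ∈ (Set.univ : Set X), e x = 1 := by
    refine isCompact_univ.induction_on (p := fun s => ∃ e : LocallyConstant X R,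
      χ e = 0 ∧ ∀ x ∈ s, e x = 1) ⟨0, map_zero χ, by simp⟩ ?_ ?_ ?_
    · rintro s t hst ⟨e, he, h1⟩
      exact ⟨e, he, fun x hx => h1 x (hst hx)⟩
    · rintro s t ⟨e, he, h1⟩ ⟨e', he', h1'⟩
      refine ⟨e + e' - e * e', by simp [he, he'], ?_⟩
      rintro x (hx | hx)
      · simp [sub_apply, add_apply, mul_apply, h1 x hx]
      · simp [sub_apply, add_apply, mul_apply, h1' x hx]
    · intro x _
      obtain ⟨f, hf⟩ := h x
      have hU : IsClopen {z | f z = f x} := f.isLocallyConstant.isClopen_fiber _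
      have hidem : charFn R hU * charFn R hU = charFn R hU := by
        ext z
        by_cases hz : z ∈ {z | f z = f x} <;> simp [coe_charFn, hz]
      have hmul : charFn R hU * f = f x • charFn R hU := by
        ext z
        by_cases hz : f z = f x <;> simp [coe_charFn, Set.indicator, hz]
      refine ⟨_, mem_nhdsWithin_of_mem_nhds (hU.isOpen.mem_nhds rfl), charFn R hU, ?_,
        fun z hz => (charFn_eq_one R z hU).2 hz⟩
      refine (hR _ (by rw [← map_mul, hidem])).resolve_right fun h1 => hf ?_
      simpa [h1] using congrArg χ hmul
  obtain ⟨e, he, h1⟩ := key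
  have he1 : e = 1 := by
    ext z
    simpa using h1 z trivial
  simp [he1] at he

end LocallyConstant


/-- Lemma 3.7, second part: with `R` indecomposable, `X`, `Y` compact Stone spaces and
`φ : Lc(X,R) → Lc(Y,R)` a surjective unital `R`-algebra homomorphism, the common zero set
`F` of `ker φ`, with the subspace topology, is homeomorphic to `Y`. -/
theorem stmt_7 {R : Type*} [CommRing R] [Nontrivial R]
    (hR : ∀ e : R, e * e = e → e = 0 ∨ e = 1)
    {X Y : Type*} [TopologicalSpace X] [CompactSpace X] [T2Space X]
    [TotallyDisconnectedSpace X]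
    [TopologicalSpace Y] [CompactSpace Y] [T2Space Y] [TotallyDisconnectedSpace Y]
    (φ : LocallyConstant X R →ₐ[R] LocallyConstant Y R)
    (hφ : Function.Surjective φ) :
    Nonempty (({x : X | ∀ f : LocallyConstant X R, φ f = 0 → f x = 0} : Set X) ≃ₜ Y) := by
  choose g hg using fun y : Y =>
    LocallyConstant.exists_eq_eval hR ((LocallyConstant.evalₐ R y).comp φ)
  replace hg : ∀ y f, φ f y = f (g y) := hg
  have hcont : Continuous g := by
    refine isTopologicalBasis_isClopen.continuous_iff.2 fun U hU => ?_
    have : g ⁻¹' U = {y | φ (LocallyConstant.charFn R hU) y = 1} := by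
      ext y
      simp [hg, LocallyConstant.charFn_eq_one]
    rw [this]
    exact (φ _).isLocallyConstant.isOpen_fiber 1
  have hinj : Function.Injective g := by
    intro y y' hyy
    by_contra hne
    obtain ⟨U, hU, hy, hy'⟩ := exists_isClopen_of_totally_separated hne
    obtain ⟨f, hf⟩ := hφ (LocallyConstant.charFn R hU)
    have h1 := (LocallyConstant.charFn_eq_one R y hU).2 hy
    have h0 := (LocallyConstant.charFn_eq_zero R y' hU).2 hy'
    rw [← hf, hg] at h0 h1
    rw [hyy, h0] at h1
    exact zero_ne_one h1
  have hemb := hcont.isClosedEmbedding hinj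
  have hrange : Set.range g = {x : X | ∀ f : LocallyConstant X R, φ f = 0 → f x = 0} := by
    refine Set.Subset.antisymm ?_ fun x hx => ?_
    · rintro _ ⟨y, rfl⟩ f hf
      rw [← hg, hf, LocallyConstant.zero_apply]
    · by_contra hxr
      obtain ⟨U, hU, hxU, hUr⟩ :=
        compact_exists_isClopen_in_isOpen hemb.isClosed_range.isOpen_compl hxr
      refine (LocallyConstant.charFn_eq_zero R x hU).1 (hx _ ?_) hxU
      ext y
      rw [hg, LocallyConstant.zero_apply, LocallyConstant.charFn_eq_zero]
      exact fun hy => hUr hy ⟨y, rfl⟩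
  exact ⟨((hemb.isEmbedding.toHomeomorph).trans (Homeomorph.setCongr hrange)).symm⟩
end

section
/- Let 𝒜 be a nonempty alphabet, X ⊆ 𝒜^ℕ a subshift, 𝔽 the free group on 𝒜, R a nonzero unital commutative ring, and B a unital R-algebra. Suppose given elements s_a, s*_a ∈ B for each a ∈ 𝒜 and p_A ∈ B for each A ∈ 𝒰 such that: p_X = 1, p_{A∩B} = p_A p_B, p_{A∪B} = p_A + p_B − p_{A∩B}, and p_∅ = 0 for all A, B ∈ 𝒰; s_a s*_a s_a = s_a and s*_a s_a s*_a = s*_a for all a ∈ 𝒜; and s_β s*_α s_α s*_β = p_{C(α,β)} for all α, β ∈ L_X, where s_ω = s*_ω = 1 and for α = α₁…αₙ ∈ L_X one sets s_α := s_{α₁}⋯s_{αₙ} and s*_α := s*_{αₙ}⋯s*_{α₁}. Then the map π : 𝔽 → B defined by π(g) = s_α s*_β if g is simple with respect to X with reduced form αβ⁻¹ (α, β ∈ L_X), and π(g) = 0 otherwise, is a partial representation of 𝔽 in B. -/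
/-! Basic subshift vocabulary. -/

/-- Concatenation of a finite word with an infinite sequence. -/
def wcat {A : Type*} (w : List A) (y : ℕ → A) : ℕ → A :=
  fun n => if h : n < w.length then w.get ⟨n, h⟩ else y (n - w.length)

/-- `w` occurs as a (finite) factor of the sequence `x`. -/
def IsFactor {A : Type*} (w : List A) (x : ℕ → A) : Prop :=
  ∃ n : ℕ, ∀ i : Fin w.length, x (n + i) = w.get i

/-- The subshift `X_F ⊆ A^ℕ` determined by a set `F` of forbidden words. -/
def subshift {A : Type*} (Forb : Set (List A)) : Set (ℕ → A) :=
  {x | ∀ w ∈ Forb, ¬ IsFactor w x}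

/-- The language of a set of sequences: all finite words (including the empty word)
occurring as factors of its elements. -/
def lang {A : Type*} (Xs : Set (ℕ → A)) : Set (List A) :=
  {w | w = [] ∨ ∃ x ∈ Xs, IsFactor w x}

/-- `C(α, β) = {βx ∈ X : αx ∈ X}`. -/
def Cab {A : Type*} (Xs : Set (ℕ → A)) (α β : List A) : Set (ℕ → A) :=
  {z | ∃ y : ℕ → A, z = wcat β y ∧ wcat β y ∈ Xs ∧ wcat α y ∈ Xs}

/-- The element of the free group on `A` determined by a word over `A`. -/
def fgw {A : Type*} (w : List A) : FreeGroup A := (w.map FreeGroup.of).prod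

/-- `ξ_x = {g ∈ 𝔽 : g = βα⁻¹ for some α, β ∈ L_X with x ∈ C(α,β)}`. -/
def xiSet {A : Type*} (Xs : Set (ℕ → A)) (x : ℕ → A) : Set (FreeGroup A) :=
  {g | ∃ α ∈ lang Xs, ∃ β ∈ lang Xs, g = fgw β * (fgw α)⁻¹ ∧ x ∈ Cab Xs α β}

/-- `α` and `β` do not end in the same letter, i.e. `αβ⁻¹` is in reduced form. -/
def NoCommonLast {A : Type*} (α β : List A) : Prop :=
  ∀ a : A, α.getLast? = some a → β.getLast? ≠ some a

/-- The Boolean algebra `𝒰` of subsets of the subshift generated by the sets `C(α,β)`. -/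
inductive InU {A : Type*} (Xs : Set (ℕ → A)) : Set (ℕ → A) → Prop
  | basic : ∀ α ∈ lang Xs, ∀ β ∈ lang Xs, InU Xs (Cab Xs α β)
  | empty : InU Xs ∅
  | union : ∀ U V : Set (ℕ → A), InU Xs U → InU Xs V → InU Xs (U ∪ V)
  | inter : ∀ U V : Set (ℕ → A), InU Xs U → InU Xs V → InU Xs (U ∩ V)
  | diff : ∀ U V : Set (ℕ → A), InU Xs U → InU Xs V → InU Xs (U \ V)

/-- `s_α = s_{α₁} ⋯ s_{αₙ}`. -/
def sW {A B : Type*} [Ring B] (s : A → B) (w : List A) : B := (w.map s).prod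

/-- `s*_α = s*_{αₙ} ⋯ s*_{α₁}`. -/
def sStarW {A B : Type*} [Ring B] (t : A → B) (w : List A) : B := (w.reverse.map t).prod

open FreeGroup in
/-- Reading off reduced words, a family of elements `σ` indexed by signed letters, such that
formal inverses are von Neumann inverses and all the resulting idempotents lie in a commuting set
stable under conjugation, satisfies the right partial multiplicativity law. -/
theorem FreeGroup.prod_map_toWord_partial_mul {A M : Type*} [DecidableEq A] [Monoid M]
    (σ : A × Bool → M) (hσ : ∀ x : A × Bool, σ x * σ (x.1, !x.2) * σ x = σ x)
    (E : Set M) (h_one : 1 ∈ E) (h_comm : ∀ e ∈ E, ∀ f ∈ E, e * f = f * e)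
    (h_conj : ∀ x : A × Bool, ∀ e ∈ E, σ x * e * σ (x.1, !x.2) ∈ E) (g h : FreeGroup A) :
    (g.toWord.map σ).prod * (h.toWord.map σ).prod * (h⁻¹.toWord.map σ).prod =
      ((g * h).toWord.map σ).prod * (h⁻¹.toWord.map σ).prod := by
  have mul_letter : ∀ (g : FreeGroup A) (x : A × Bool),
      ((g * mk [x]).toWord.map σ).prod * σ (x.1, !x.2) =
        (g.toWord.map σ).prod * σ x * σ (x.1, !x.2) := by
    intro g x
    by_cases hx : ∃ u, g.toWord = u ++ [(x.1, !x.2)]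
    · obtain ⟨u, hu⟩ := hx
      have hred : IsReduced u := (isReduced_toWord (x := g)).infix ⟨[], [(x.1, !x.2)], by simp [hu]⟩
      have hg : g * mk [x] = mk u := by
        rw [← mk_toWord (x := g), hu, ← mul_mk, mul_assoc]
        have : (mk [(x.1, !x.2)] : FreeGroup A) = (mk [x])⁻¹ := by simp [inv_mk, invRev]
        rw [this, inv_mul_cancel, mul_one]
      rw [hg, toWord_mk, hred.reduce_eq, hu]
      have := hσ (x.1, !x.2)
      simp only [Bool.not_not, Prod.mk.eta] at this
      simp only [List.map_append, List.map_cons, List.map_nil, List.prod_append,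
        List.prod_singleton]
      rw [mul_assoc, mul_assoc, ← mul_assoc (σ (x.1, !x.2)), this]
    · have hred : IsReduced (g.toWord ++ [x]) := by
        rw [IsReduced, List.isChain_append]
        refine ⟨isReduced_toWord, by simp, ?_⟩
        intro y hy z hz hyz
        simp only [List.head?_cons, Option.mem_def, Option.some.injEq] at hz
        subst hz
        by_contra hne
        apply hx
        refine ⟨g.toWord.dropLast, ?_⟩
        have hy' : y = (x.1, !x.2) := by
          ext
          · exact hyz
          · cases hb : y.2 <;> cases hc : x.2 <;> simp_all
        rw [← hy']
        exact (List.dropLast_append_getLast? y hy).symm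
      rw [toWord_mul, toWord_mk, IsReduced.singleton.reduce_eq, hred.reduce_eq]
      simp
  have proj_mem : ∀ w : List (A × Bool), (w.map σ).prod * ((invRev w).map σ).prod ∈ E := by
    intro w
    induction w with
    | nil => simpa using h_one
    | cons x w ih =>
      have := h_conj x _ ih
      rw [invRev_cons]
      simpa [invRev, mul_assoc] using this
  have mul_word : ∀ (w : List (A × Bool)) (g : FreeGroup A),
      (g.toWord.map σ).prod * (w.map σ).prod * ((invRev w).map σ).prod =
        ((g * mk w).toWord.map σ).prod * ((invRev w).map σ).prod := by
    intro w
    induction w with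
    | nil => intro g; simp [← one_eq_mk]
    | cons x w ih =>
      intro g
      have hcons : mk (x :: w) = mk [x] * mk w := by simp [mul_mk]
      have hrev : ((invRev (x :: w)).map σ).prod = ((invRev w).map σ).prod * σ (x.1, !x.2) := by
        rw [invRev_cons]; simp [invRev]
      have hsrc : σ (x.1, !x.2) * σ x ∈ E := by
        simpa using h_conj (x.1, !x.2) 1 h_one
      have hc := h_comm _ hsrc _ (proj_mem w)
      rw [hcons, hrev, ← mul_assoc g, ← mul_assoc, ← mul_assoc, ← ih, List.map_cons,
        List.prod_cons]
      set e := (w.map σ).prod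
      set f := ((invRev w).map σ).prod
      have hx' := hσ (x.1, !x.2)
      simp only [Bool.not_not, Prod.mk.eta] at hx'
      calc (g.toWord.map σ).prod * (σ x * e) * f * σ (x.1, !x.2)
          = (g.toWord.map σ).prod * (σ x * σ (x.1, !x.2) * σ x) * e * f * σ (x.1, !x.2) := by
            rw [hσ]; simp only [mul_assoc]
        _ = ((g.toWord.map σ).prod * σ x * σ (x.1, !x.2)) * σ x * e * f * σ (x.1, !x.2) := by
            simp only [mul_assoc]
        _ = ((g * mk [x]).toWord.map σ).prod * (σ (x.1, !x.2) * σ x * (e * f)) *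
              σ (x.1, !x.2) := by
            rw [← mul_letter]; simp only [mul_assoc]
        _ = ((g * mk [x]).toWord.map σ).prod * (e * f) *
              (σ (x.1, !x.2) * σ x * σ (x.1, !x.2)) := by
            rw [hc]; simp only [mul_assoc]
        _ = _ := by rw [hx']; simp only [mul_assoc]
  have := mul_word h.toWord g
  rwa [mk_toWord, ← toWord_inv] at this

open FreeGroup in
/-- The left-handed version of `FreeGroup.prod_map_toWord_partial_mul`. -/
theorem FreeGroup.prod_map_toWord_partial_mul' {A M : Type*} [DecidableEq A] [Monoid M]
    (σ : A × Bool → M) (hσ : ∀ x : A × Bool, σ x * σ (x.1, !x.2) * σ x = σ x)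
    (E : Set M) (h_one : 1 ∈ E) (h_comm : ∀ e ∈ E, ∀ f ∈ E, e * f = f * e)
    (h_conj : ∀ x : A × Bool, ∀ e ∈ E, σ x * e * σ (x.1, !x.2) ∈ E) (g h : FreeGroup A) :
    (g⁻¹.toWord.map σ).prod * (g.toWord.map σ).prod * (h.toWord.map σ).prod =
      (g⁻¹.toWord.map σ).prod * ((g * h).toWord.map σ).prod := by
  have key : ∀ w : List (A × Bool), ((w.map fun x => MulOpposite.op (σ (x.1, !x.2))).prod) =
      MulOpposite.op (((invRev w).map σ).prod) := by
    intro w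
    induction w with
    | nil => simp
    | cons x w ih => rw [invRev_cons, List.map_cons, List.prod_cons, ih]; simp [invRev]
  have := FreeGroup.prod_map_toWord_partial_mul (fun x => MulOpposite.op (σ (x.1, !x.2)))
    (fun x => by
      have := hσ (x.1, !x.2)
      exact MulOpposite.unop_injective (by simpa [mul_assoc] using this))
    {e | e.unop ∈ E} h_one
    (fun e he f hf => MulOpposite.unop_injective (h_comm _ hf _ he))
    (fun x e he => by simpa [mul_assoc] using h_conj x _ he) h⁻¹ g⁻¹
  simp only [key, ← toWord_inv, ← MulOpposite.op_mul] at this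
  simpa [mul_assoc] using MulOpposite.op_injective this

theorem sW_nil {A B : Type*} [Ring B] (s : A → B) : sW s [] = 1 := rfl

theorem sStarW_nil {A B : Type*} [Ring B] (t : A → B) : sStarW t [] = 1 := rfl

theorem sW_singleton {A B : Type*} [Ring B] (s : A → B) (a : A) : sW s [a] = s a := by
  simp [sW]

theorem sStarW_singleton {A B : Type*} [Ring B] (t : A → B) (a : A) : sStarW t [a] = t a := by
  simp [sStarW]

theorem sW_cons {A B : Type*} [Ring B] (s : A → B) (a : A) (w : List A) :
    sW s (a :: w) = s a * sW s w := by
  simp [sW]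

theorem sStarW_cons {A B : Type*} [Ring B] (t : A → B) (a : A) (w : List A) :
    sStarW t (a :: w) = sStarW t w * t a := by
  simp [sStarW]

theorem sW_concat {A B : Type*} [Ring B] (s : A → B) (a : A) (w : List A) :
    sW s (w ++ [a]) = sW s w * s a := by
  simp [sW]

theorem sStarW_concat {A B : Type*} [Ring B] (t : A → B) (a : A) (w : List A) :
    sStarW t (w ++ [a]) = t a * sStarW t w := by
  simp [sStarW]

/-- The image `s_β s*_α s_α s*_β` of `C(α, β)`. -/
def cylProj {A B : Type*} [Ring B] (s t : A → B) (α β : List A) : B :=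
  sW s β * sStarW t α * sW s α * sStarW t β

/-- The relations between the generators `s_a`, `t_a = s*_a` attached to a factorial language `L`
that do not mention the idempotents `p_A`. Generators outside the language are zero. -/
structure LangRel {A B : Type*} [Ring B] (L : Set (List A)) (s t : A → B) : Prop where
  nil_mem : [] ∈ L
  left_mem : ∀ u v, u ++ v ∈ L → u ∈ L
  right_mem : ∀ u v, u ++ v ∈ L → v ∈ L
  s_zero : ∀ a, [a] ∉ L → s a = 0
  t_zero : ∀ a, [a] ∉ L → t a = 0
  sts : ∀ a, s a * t a * s a = s a
  tst : ∀ a, t a * s a * t a = t a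
  comm : ∀ α ∈ L, ∀ β ∈ L, ∀ γ ∈ L, ∀ δ ∈ L,
    cylProj s t α β * cylProj s t γ δ = cylProj s t γ δ * cylProj s t α β
  follower_mul : ∀ β ∈ L, ∀ a, [a] ∈ L → β ++ [a] ∉ L →
    cylProj s t β [] * cylProj s t [] [a] = 0
  cyl_mul : ∀ a b, [a] ∈ L → [b] ∈ L → a ≠ b →
    cylProj s t [] [a] * cylProj s t [] [b] = 0

namespace LangRel

variable {A B : Type*} [Ring B] {L : Set (List A)} {s t : A → B}

theorem follower_comm (H : LangRel L s t) {w : List A} {a : A} (hw : w ∈ L) (ha : [a] ∈ L) :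
    sStarW t w * sW s w * (s a * t a) = s a * t a * (sStarW t w * sW s w) := by
  simpa [cylProj, sW_nil, sStarW_nil, sW_singleton, sStarW_singleton]
    using H.comm w hw [] H.nil_mem [] H.nil_mem [a] ha

theorem sW_mul_sStarW_mul_sW (H : LangRel L s t) (w : List A) (hw : w ∈ L) :
    sW s w * sStarW t w * sW s w = sW s w := by
  induction w using List.reverseRecOn with
  | nil => simp [sW_nil, sStarW_nil]
  | append_singleton w a ih =>
    have hw' := H.left_mem _ _ hw
    have hc := H.follower_comm hw' (H.right_mem _ _ hw)
    calc _ = sW s w * (s a * t a * (sStarW t w * sW s w)) * s a := by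
          rw [sW_concat, sStarW_concat]; simp only [mul_assoc]
      _ = (sW s w * sStarW t w * sW s w) * (s a * t a * s a) := by
          rw [← hc]; simp only [mul_assoc]
      _ = _ := by rw [ih hw', H.sts, sW_concat]

theorem sStarW_mul_sW_mul_sStarW (H : LangRel L s t) (w : List A) (hw : w ∈ L) :
    sStarW t w * sW s w * sStarW t w = sStarW t w := by
  induction w using List.reverseRecOn with
  | nil => simp [sW_nil, sStarW_nil]
  | append_singleton w a ih =>
    have hw' := H.left_mem _ _ hw
    have hc := H.follower_comm hw' (H.right_mem _ _ hw)
    calc _ = t a * (sStarW t w * sW s w * (s a * t a)) * sStarW t w := by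
          rw [sW_concat, sStarW_concat]; simp only [mul_assoc]
      _ = (t a * s a * t a) * (sStarW t w * sW s w * sStarW t w) := by
          rw [hc]; simp only [mul_assoc]
      _ = _ := by rw [ih hw', H.tst, sStarW_concat]

theorem follower_mul_eq_zero (H : LangRel L s t) {w : List A} {a : A} (hw : w ∈ L) (ha : [a] ∈ L)
    (hwa : w ++ [a] ∉ L) : sStarW t w * sW s w * (s a * t a) = 0 := by
  simpa [cylProj, sW_nil, sStarW_nil, sW_singleton, sStarW_singleton]
    using H.follower_mul w hw a ha hwa

theorem sW_eq_zero (H : LangRel L s t) (w : List A) (hw : w ∉ L) : sW s w = 0 := by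
  induction w using List.reverseRecOn with
  | nil => exact absurd H.nil_mem hw
  | append_singleton w a ih =>
    rw [sW_concat]
    by_cases hwL : w ∈ L
    · by_cases ha : [a] ∈ L
      · calc sW s w * s a = (sW s w * sStarW t w * sW s w) * (s a * t a * s a) := by
              rw [H.sW_mul_sStarW_mul_sW w hwL, H.sts]
          _ = sW s w * (sStarW t w * sW s w * (s a * t a)) * s a := by simp only [mul_assoc]
          _ = 0 := by rw [H.follower_mul_eq_zero hwL ha hw]; simp
      · rw [H.s_zero a ha, mul_zero]
    · rw [ih hwL, zero_mul]

theorem sStarW_eq_zero (H : LangRel L s t) (w : List A) (hw : w ∉ L) : sStarW t w = 0 := by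
  induction w using List.reverseRecOn with
  | nil => exact absurd H.nil_mem hw
  | append_singleton w a ih =>
    rw [sStarW_concat]
    by_cases hwL : w ∈ L
    · by_cases ha : [a] ∈ L
      · calc t a * sStarW t w = (t a * s a * t a) * (sStarW t w * sW s w * sStarW t w) := by
              rw [H.sStarW_mul_sW_mul_sStarW w hwL, H.tst]
          _ = t a * (s a * t a * (sStarW t w * sW s w)) * sStarW t w := by simp only [mul_assoc]
          _ = 0 := by rw [← H.follower_comm hwL ha, H.follower_mul_eq_zero hwL ha hw]; simp
      · rw [H.t_zero a ha, zero_mul]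
    · rw [ih hwL, mul_zero]

theorem t_mul_s (H : LangRel L s t) {a b : A} (hab : a ≠ b) : t a * s b = 0 := by
  by_cases ha : [a] ∈ L
  · by_cases hb : [b] ∈ L
    · have h0 : s a * t a * (s b * t b) = 0 := by
        simpa [cylProj, sW_nil, sStarW_nil, sW_singleton, sStarW_singleton]
          using H.cyl_mul a b ha hb hab
      calc t a * s b = (t a * s a * t a) * (s b * t b * s b) := by rw [H.sts, H.tst]
        _ = t a * (s a * t a * (s b * t b)) * s b := by simp only [mul_assoc]
        _ = 0 := by rw [h0]; simp
    · rw [H.s_zero b hb, mul_zero]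
  · rw [H.t_zero a ha, zero_mul]

/-- The set of elements `s_β s*_α s_α s*_β` together with zero. -/
def projSet (L : Set (List A)) (s t : A → B) : Set B :=
  {e | e = 0 ∨ ∃ α ∈ L, ∃ β ∈ L, e = cylProj s t α β}

/-- The commutative monoid of idempotents generated by `projSet`. -/
def projMonoid (L : Set (List A)) (s t : A → B) : Submonoid B :=
  Submonoid.closure (projSet L s t)

theorem cylProj_mem (H : LangRel L s t) (α β : List A) : cylProj s t α β ∈ projMonoid L s t := by
  apply Submonoid.subset_closure
  by_cases hα : α ∈ L
  · by_cases hβ : β ∈ L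
    · exact Or.inr ⟨α, hα, β, hβ, rfl⟩
    · exact Or.inl (by simp [cylProj, H.sW_eq_zero β hβ])
  · exact Or.inl (by simp [cylProj, H.sW_eq_zero α hα])

theorem projMonoid_comm (H : LangRel L s t) :
    ∀ e ∈ projMonoid L s t, ∀ f ∈ projMonoid L s t, e * f = f * e := by
  have hgen : ∀ e ∈ projSet L s t, ∀ f ∈ projSet L s t, Commute e f := by
    rintro e (rfl | ⟨α, hα, β, hβ, rfl⟩) f (rfl | ⟨γ, hγ, δ, hδ, rfl⟩)
    · exact Commute.zero_left _
    · exact Commute.zero_left _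
    · exact Commute.zero_right _
    · exact H.comm α hα β hβ γ hγ δ hδ
  intro e he f hf
  have h1 : ∀ x ∈ projSet L s t, Commute x f := fun x hx =>
    Submonoid.closure_induction (motive := fun y _ => Commute x y) (fun y hy => hgen x hx y hy)
      (Commute.one_right x) (fun _ _ _ _ => Commute.mul_right) hf
  exact Submonoid.closure_induction (motive := fun y _ => Commute y f) h1
    (Commute.one_left f) (fun _ _ _ _ => Commute.mul_left) he

/-- The generator attached to a signed letter. -/
def letter (s t : A → B) (x : A × Bool) : B := if x.2 then s x.1 else t x.1

theorem letter_mul_letter_mul_letter (H : LangRel L s t) (x : A × Bool) :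
    letter s t x * letter s t (x.1, !x.2) * letter s t x = letter s t x := by
  obtain ⟨a, b⟩ := x
  cases b
  · simpa [letter] using H.tst a
  · simpa [letter] using H.sts a

theorem s_mul_gen_mul_t_mem (H : LangRel L s t) (a : A) (e : B) (he : e ∈ projSet L s t) :
    s a * e * t a ∈ projMonoid L s t := by
  obtain rfl | ⟨α, -, β, -, rfl⟩ := he
  · exact Submonoid.subset_closure (Or.inl (by simp))
  · have := H.cylProj_mem α (a :: β)
    simpa [cylProj, sW_cons, sStarW_cons, mul_assoc] using this

theorem t_mul_gen_mul_s_mem (H : LangRel L s t) (a : A) (e : B) (he : e ∈ projSet L s t) :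
    t a * e * s a ∈ projMonoid L s t := by
  obtain rfl | ⟨α, -, β, -, rfl⟩ := he
  · exact Submonoid.subset_closure (Or.inl (by simp))
  · cases β with
    | nil =>
      have := H.cylProj_mem (α ++ [a]) []
      simpa [cylProj, sW_concat, sStarW_concat, sW_nil, sStarW_nil, mul_assoc] using this
    | cons b β =>
      by_cases hab : a = b
      · subst hab
        have h1 := H.cylProj_mem [a] []
        have h2 := mul_mem (mul_mem h1 (H.cylProj_mem α β)) h1
        simpa [cylProj, sW_cons, sStarW_cons, sW_nil, sStarW_nil, mul_assoc] using h2
      · refine Submonoid.subset_closure (Or.inl ?_)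
        rw [cylProj, sW_cons]
        simp only [← mul_assoc]
        rw [H.t_mul_s hab]
        simp

theorem letter_conj_mem (H : LangRel L s t) (x : A × Bool) (e : B) (he : e ∈ projMonoid L s t) :
    letter s t x * e * letter s t (x.1, !x.2) ∈ projMonoid L s t := by
  have hts : ∀ x : A × Bool, letter s t x * letter s t (x.1, !x.2) ∈ projMonoid L s t := by
    rintro ⟨a, b⟩
    cases b
    · simpa [letter, cylProj, sW_singleton, sStarW_singleton, sW_nil, sStarW_nil]
        using H.cylProj_mem [a] []
    · simpa [letter, cylProj, sW_singleton, sStarW_singleton, sW_nil, sStarW_nil]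
        using H.cylProj_mem [] [a]
  induction he using Submonoid.closure_induction with
  | mem e he =>
    obtain ⟨a, b⟩ := x
    cases b
    · simpa [letter] using H.t_mul_gen_mul_s_mem a e he
    · simpa [letter] using H.s_mul_gen_mul_t_mem a e he
  | one => simpa using hts x
  | mul e f he hf ihe ihf =>
    have hsrc := hts (x.1, !x.2)
    simp only [Bool.not_not, Prod.mk.eta] at hsrc
    have hc := H.projMonoid_comm _ hsrc e he
    have : letter s t x * (e * f) * letter s t (x.1, !x.2) =
        (letter s t x * e * letter s t (x.1, !x.2)) *
          (letter s t x * f * letter s t (x.1, !x.2)) := by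
      calc _ = letter s t x * letter s t (x.1, !x.2) * letter s t x * (e * f) *
              letter s t (x.1, !x.2) := by rw [H.letter_mul_letter_mul_letter]
        _ = letter s t x * (letter s t (x.1, !x.2) * letter s t x * e) * f *
              letter s t (x.1, !x.2) := by simp only [mul_assoc]
        _ = _ := by rw [hc]; simp only [mul_assoc]
    rw [this]
    exact mul_mem ihe ihf

/-- The signed word `αβ⁻¹`. -/
def signedWord (α β : List A) : List (A × Bool) :=
  α.map (·, true) ++ (β.map (·, false)).reverse

theorem prod_map_letter_signedWord (s t : A → B) (α β : List A) :
    ((signedWord α β).map (letter s t)).prod = sW s α * sStarW t β := by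
  simp [signedWord, letter, sW, sStarW, Function.comp_def]

theorem mk_signedWord (α β : List A) :
    FreeGroup.mk (signedWord α β) = fgw α * (fgw β)⁻¹ := by
  have h : ∀ w : List A, fgw w = FreeGroup.mk (w.map (·, true)) := by
    intro w
    induction w with
    | nil => simp [fgw, ← FreeGroup.one_eq_mk]
    | cons a w ih =>
      have : fgw (a :: w) = FreeGroup.of a * fgw w := by simp [fgw]
      rw [this, ih, FreeGroup.of, FreeGroup.mul_mk]
      simp
  rw [h, h, FreeGroup.inv_mk, FreeGroup.mul_mk]
  simp [signedWord, FreeGroup.invRev, Function.comp_def]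

theorem isReduced_signedWord {α β : List A} (h : NoCommonLast α β) :
    FreeGroup.IsReduced (signedWord α β) := by
  rw [FreeGroup.IsReduced, signedWord, List.isChain_append]
  refine ⟨?_, ?_, ?_⟩
  · rw [List.isChain_map]
    exact (List.pairwise_of_forall (by simp)).isChain
  · rw [← List.map_reverse, List.isChain_map]
    exact (List.pairwise_of_forall (by simp)).isChain
  · intro x hx y hy hxy
    simp only [List.getLast?_map, List.head?_reverse, Option.mem_def, Option.map_eq_some_iff]
      at hx hy
    obtain ⟨a, ha, rfl⟩ := hx
    obtain ⟨b, hb, rfl⟩ := hy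
    simp only at hxy
    subst hxy
    exact absurd hb (h _ ha)

/-- A reduced signed word either has zero product or has the form `αβ⁻¹`. -/
theorem prod_eq_zero_or_eq_signedWord (H : LangRel L s t) (w : List (A × Bool))
    (hw : FreeGroup.IsReduced w) :
    (w.map (letter s t)).prod = 0 ∨ ∃ α β, w = signedWord α β := by
  induction w with
  | nil => exact Or.inr ⟨[], [], rfl⟩
  | cons x w ih =>
    obtain h0 | ⟨α, β, rfl⟩ := ih (hw.infix ⟨[x], [], by simp⟩)
    · left; simp [h0]
    · obtain ⟨a, b⟩ := x
      cases b
      · cases α with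
        | nil => exact Or.inr ⟨[], β ++ [a], by simp [signedWord]⟩
        | cons c α =>
          left
          have hac : a ≠ c := by
            rintro rfl
            simp [signedWord, FreeGroup.isReduced_cons_cons] at hw
          rw [List.map_cons, List.prod_cons, prod_map_letter_signedWord, sW_cons]
          simp only [letter, ← mul_assoc]
          simp [H.t_mul_s hac]
      · exact Or.inr ⟨a :: α, β, by simp [signedWord]⟩

theorem exists_noCommonLast (H : LangRel L s t) (α β : List A) (hα : α ∈ L) (hβ : β ∈ L) :
    ∃ α' ∈ L, ∃ β' ∈ L, NoCommonLast α' β' ∧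
      fgw α * (fgw β)⁻¹ = fgw α' * (fgw β')⁻¹ := by
  induction α using List.reverseRecOn generalizing β with
  | nil => exact ⟨[], hα, β, hβ, by simp [NoCommonLast], rfl⟩
  | append_singleton α a ih =>
    by_cases hlast : β.getLast? = some a
    · obtain ⟨γ, rfl⟩ : ∃ γ, β = γ ++ [a] :=
        ⟨β.dropLast, (List.dropLast_append_getLast? a hlast).symm⟩
      obtain ⟨α', hα', β', hβ', hn, he⟩ := ih γ (H.left_mem _ _ hα) (H.left_mem _ _ hβ)
      refine ⟨α', hα', β', hβ', hn, ?_⟩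
      rw [← he]
      simp [fgw, mul_assoc]
    · refine ⟨α ++ [a], hα, β, hβ, ?_, rfl⟩
      intro b hb
      simp only [List.getLast?_concat, Option.some.injEq] at hb
      exact hb ▸ hlast

theorem eq_prod_map_letter [DecidableEq A] (H : LangRel L s t) (π : FreeGroup A → B)
    (hπ_simple : ∀ α ∈ L, ∀ β ∈ L,
      NoCommonLast α β → π (fgw α * (fgw β)⁻¹) = sW s α * sStarW t β)
    (hπ_zero : ∀ g : FreeGroup A,
      (¬ ∃ α ∈ L, ∃ β ∈ L, g = fgw α * (fgw β)⁻¹) → π g = 0) (g : FreeGroup A) :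
    π g = (g.toWord.map (letter s t)).prod := by
  by_cases hg : ∃ α ∈ L, ∃ β ∈ L, g = fgw α * (fgw β)⁻¹
  · obtain ⟨α, hα, β, hβ, rfl⟩ := hg
    obtain ⟨γ, hγ, δ, hδ, hn, he⟩ := H.exists_noCommonLast α β hα hβ
    rw [he, hπ_simple γ hγ δ hδ hn, ← mk_signedWord, FreeGroup.toWord_mk,
      (isReduced_signedWord hn).reduce_eq, prod_map_letter_signedWord]
  · rw [hπ_zero g hg]
    obtain h0 | ⟨α, β, hw⟩ := H.prod_eq_zero_or_eq_signedWord g.toWord FreeGroup.isReduced_toWord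
    · exact h0.symm
    · rw [hw, prod_map_letter_signedWord]
      by_cases hα : α ∈ L
      · by_cases hβ : β ∈ L
        · exact absurd ⟨α, hα, β, hβ, by rw [← mk_signedWord, ← hw, FreeGroup.mk_toWord]⟩ hg
        · rw [H.sStarW_eq_zero β hβ, mul_zero]
      · rw [H.sW_eq_zero α hα, zero_mul]

end LangRel

theorem wcat_append {A : Type*} (u v : List A) (y : ℕ → A) :
    wcat (u ++ v) y = wcat u (wcat v y) := by
  funext n
  simp only [wcat, List.get_eq_getElem, List.length_append]
  by_cases h1 : n < u.length
  · simp [h1, Nat.lt_add_right, List.getElem_append_left]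
  · by_cases h2 : n < u.length + v.length
    · have h3 : n - u.length < v.length := by omega
      simp [h1, h2, h3, List.getElem_append_right (Nat.le_of_not_lt h1)]
    · have h3 : ¬ n - u.length < v.length := by omega
      simp [h1, h2, h3, Nat.sub_sub]

theorem wcat_nil {A : Type*} (y : ℕ → A) : wcat [] y = y := by
  funext n; simp [wcat]

theorem isFactor_wcat {A : Type*} (w : List A) (y : ℕ → A) : IsFactor w (wcat w y) :=
  ⟨0, fun i => by simp [wcat]⟩

theorem lang_left_mem {A : Type*} (X : Set (ℕ → A)) (u v : List A) (h : u ++ v ∈ lang X) :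
    u ∈ lang X := by
  obtain h | ⟨x, hx, n, hn⟩ := h
  · exact Or.inl (List.append_eq_nil_iff.mp h).1
  · refine Or.inr ⟨x, hx, n, fun i => ?_⟩
    have := hn ⟨i, by simp; omega⟩
    simpa [List.getElem_append_left] using this

theorem lang_right_mem {A : Type*} (X : Set (ℕ → A)) (u v : List A) (h : u ++ v ∈ lang X) :
    v ∈ lang X := by
  obtain h | ⟨x, hx, n, hn⟩ := h
  · exact Or.inl (List.append_eq_nil_iff.mp h).2
  · refine Or.inr ⟨x, hx, n + u.length, fun i => ?_⟩
    have := hn ⟨u.length + i, by simp⟩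
    simpa [List.getElem_append_right, add_assoc] using this

theorem Cab_follower_inter {A : Type*} (X : Set (ℕ → A)) (β : List A) (a : A)
    (h : β ++ [a] ∉ lang X) : Cab X β [] ∩ Cab X [] [a] = ∅ := by
  ext z
  simp only [Set.mem_inter_iff, Set.mem_empty_iff_false, iff_false]
  rintro ⟨⟨y, rfl, -, hy⟩, ⟨y', hyy', -, -⟩⟩
  rw [wcat_nil] at hyy'
  rw [hyy', ← wcat_append] at hy
  exact h (Or.inr ⟨_, hy, isFactor_wcat _ _⟩)

theorem Cab_cylinder_inter {A : Type*} (X : Set (ℕ → A)) (a b : A) (h : a ≠ b) :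
    Cab X [] [a] ∩ Cab X [] [b] = ∅ := by
  ext z
  simp only [Set.mem_inter_iff, Set.mem_empty_iff_false, iff_false]
  rintro ⟨⟨y, rfl, -, -⟩, ⟨y', hyy', -, -⟩⟩
  exact h (by simpa [wcat] using congrFun hyy' 0)

theorem sW_congr {A B : Type*} [Ring B] {s s' : A → B} {w : List A} (h : ∀ a ∈ w, s a = s' a) :
    sW s w = sW s' w := by
  rw [sW, sW, List.map_congr_left h]

theorem sStarW_congr {A B : Type*} [Ring B] {t t' : A → B} {w : List A}
    (h : ∀ a ∈ w, t a = t' a) : sStarW t w = sStarW t' w := by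
  rw [sStarW, sStarW, List.map_congr_left (fun a ha => h a (List.mem_reverse.mp ha))]

theorem singleton_mem_lang {A : Type*} {X : Set (ℕ → A)} {w : List A} (hw : w ∈ lang X) {a : A}
    (ha : a ∈ w) : [a] ∈ lang X := by
  obtain ⟨u, v, rfl⟩ := List.append_of_mem ha
  exact lang_left_mem X [a] v (by simpa using lang_right_mem X u (a :: v) hw)

/-- Proposition 5.9: given elements `s_a, s*_a` and `p_A` of a unital `R`-algebra `B`
satisfying the defining relations of the unital subshift algebra, the map
`π : 𝔽 → B` sending a simple element with reduced form `αβ⁻¹` to `s_α s*_β` and all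
non-simple elements to `0` is a partial representation of the free group `𝔽` in `B`. -/
theorem stmt_10 {A : Type*} [Nonempty A] (Forb : Set (List A))
    {R : Type*} [CommRing R] [Nontrivial R] {B : Type*} [Ring B] [Algebra R B]
    (s sStar : A → B) (p : Set (ℕ → A) → B)
    (hpX : p (subshift Forb) = 1)
    (hpInter : ∀ U V : Set (ℕ → A), InU (subshift Forb) U → InU (subshift Forb) V →
      p (U ∩ V) = p U * p V)
    (hpUnion : ∀ U V : Set (ℕ → A), InU (subshift Forb) U → InU (subshift Forb) V →
      p (U ∪ V) = p U + p V - p (U ∩ V))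
    (hpEmpty : p ∅ = 0)
    (hs : ∀ a : A, s a * sStar a * s a = s a)
    (hsStar : ∀ a : A, sStar a * s a * sStar a = sStar a)
    (hCK : ∀ α ∈ lang (subshift Forb), ∀ β ∈ lang (subshift Forb),
      sW s β * sStarW sStar α * sW s α * sStarW sStar β = p (Cab (subshift Forb) α β))
    (π : FreeGroup A → B)
    (hπ_simple : ∀ α ∈ lang (subshift Forb), ∀ β ∈ lang (subshift Forb),
      NoCommonLast α β → π (fgw α * (fgw β)⁻¹) = sW s α * sStarW sStar β)
    (hπ_zero : ∀ g : FreeGroup A,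
      (¬ ∃ α ∈ lang (subshift Forb), ∃ β ∈ lang (subshift Forb), g = fgw α * (fgw β)⁻¹) →
      π g = 0) :
    π 1 = 1 ∧
    (∀ g h : FreeGroup A, π g * π h * π h⁻¹ = π (g * h) * π h⁻¹) ∧
    (∀ g h : FreeGroup A, π g⁻¹ * π g * π h = π g⁻¹ * π (g * h)) := by
  classical
  set X := subshift Forb
  let s' : A → B := fun a => if [a] ∈ lang X then s a else 0
  let t' : A → B := fun a => if [a] ∈ lang X then sStar a else 0
  have hS : ∀ w ∈ lang X, sW s w = sW s' w := fun w hw =>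
    sW_congr fun a ha => (if_pos (singleton_mem_lang hw ha)).symm
  have hT : ∀ w ∈ lang X, sStarW sStar w = sStarW t' w := fun w hw =>
    sStarW_congr fun a ha => (if_pos (singleton_mem_lang hw ha)).symm
  have hnil : [] ∈ lang X := Or.inl rfl
  have hc : ∀ α ∈ lang X, ∀ β ∈ lang X, cylProj s' t' α β = p (Cab X α β) := by
    intro α hα β hβ
    rw [← hCK α hα β hβ, cylProj, hS α hα, hS β hβ, hT α hα, hT β hβ]
  have H : LangRel (lang X) s' t' :=
    { nil_mem := hnil
      left_mem := lang_left_mem X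
      right_mem := lang_right_mem X
      s_zero := fun a ha => if_neg ha
      t_zero := fun a ha => if_neg ha
      sts := fun a => by
        by_cases ha : [a] ∈ lang X
        · simpa [s', t', ha] using hs a
        · simp [s', ha]
      tst := fun a => by
        by_cases ha : [a] ∈ lang X
        · simpa [s', t', ha] using hsStar a
        · simp [t', ha]
      comm := fun α hα β hβ γ hγ δ hδ => by
        rw [hc α hα β hβ, hc γ hγ δ hδ,
          ← hpInter _ _ (InU.basic α hα β hβ) (InU.basic γ hγ δ hδ),
          ← hpInter _ _ (InU.basic γ hγ δ hδ) (InU.basic α hα β hβ), Set.inter_comm]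
      follower_mul := fun β hβ a ha hβa => by
        rw [hc β hβ [] hnil, hc [] hnil [a] ha,
          ← hpInter _ _ (InU.basic β hβ [] hnil) (InU.basic [] hnil [a] ha),
          Cab_follower_inter X β a hβa, hpEmpty]
      cyl_mul := fun a b ha hb hab => by
        rw [hc [] hnil [a] ha, hc [] hnil [b] hb,
          ← hpInter _ _ (InU.basic [] hnil [a] ha) (InU.basic [] hnil [b] hb),
          Cab_cylinder_inter X a b hab, hpEmpty] }
  have hπ := H.eq_prod_map_letter π
    (fun α hα β hβ hn => by rw [hπ_simple α hα β hβ hn, hS α hα, hT β hβ]) hπ_zero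
  refine ⟨by simp [hπ], fun g h => ?_, fun g h => ?_⟩
  · simp only [hπ]
    exact FreeGroup.prod_map_toWord_partial_mul _ H.letter_mul_letter_mul_letter
      (LangRel.projMonoid (lang X) s' t') (one_mem _) H.projMonoid_comm H.letter_conj_mem g h
  · simp only [hπ]
    exact FreeGroup.prod_map_toWord_partial_mul' _ H.letter_mul_letter_mul_letter
      (LangRel.projMonoid (lang X) s' t') (one_mem _) H.projMonoid_comm H.letter_conj_mem g h
end

section
/- Let 𝒜 be a nonempty alphabet and X ⊆ 𝒜^ℕ a subshift. Let α, β ∈ L_X, g ∈ 𝔽 and x ∈ X be such that βα⁻¹ is in reduced form in 𝔽 (i.e., α and β do not end in the same letter), βα⁻¹ ∈ ξ_x and βα⁻¹g ∈ ξ_x. Then g is simple with respect to X, i.e., g = μν⁻¹ for some μ, ν ∈ L_X. -/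
theorem wcat_apply_add {A : Type*} (u : List A) (y : ℕ → A) (n : ℕ) :
    wcat u y (u.length + n) = y n := by
  simp [wcat]

theorem wcat_injective {A : Type*} (u : List A) : Function.Injective (wcat u) := by
  intro y z h
  funext n
  rw [← wcat_apply_add u y n, h, wcat_apply_add]

theorem mem_lang_of_wcat_mem {A : Type*} {Xs : Set (ℕ → A)} {u : List A} {y : ℕ → A}
    (h : wcat u y ∈ Xs) : u ∈ lang Xs :=
  Or.inr ⟨_, h, 0, fun i => by simp [wcat]⟩

theorem exists_append_of_wcat_eq {A : Type*} {u v : List A} {y z : ℕ → A}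
    (h : wcat u y = wcat v z) (hl : u.length ≤ v.length) :
    ∃ w, v = u ++ w ∧ y = wcat w z := by
  have hv : v = u ++ v.drop u.length := by
    conv_lhs => rw [← List.take_append_drop u.length v]
    congr 1
    apply List.ext_getElem
    · simpa using hl
    · intro i _ hi
      have := congrFun h i
      simp only [wcat, hi, hi.trans_le hl, dif_pos, List.get_eq_getElem] at this
      simp [this]
  refine ⟨_, hv, wcat_injective u ?_⟩
  rw [← wcat_append, ← hv, h]

theorem fgw_append {A : Type*} (u v : List A) : fgw (u ++ v) = fgw u * fgw v := by
  simp [fgw]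

theorem fgw_eq_mk {A : Type*} (u : List A) :
    fgw u = FreeGroup.mk (u.map fun a => (a, true)) := by
  induction u with
  | nil => rfl
  | cons a u ih =>
    rw [show a :: u = [a] ++ u from rfl, fgw_append, ih]
    simp [fgw, FreeGroup.of, FreeGroup.mul_mk]

theorem exists_append_noCommonLast {A : Type*} (u v : List A) :
    ∃ u' v' w, u = u' ++ w ∧ v = v' ++ w ∧ NoCommonLast u' v' := by
  induction u using List.reverseRecOn generalizing v with
  | nil => exact ⟨[], v, [], by simp, by simp, by simp [NoCommonLast]⟩
  | append_singleton u a ih =>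
    by_cases hv : v.getLast? = some a
    · obtain ⟨v₀, rfl⟩ := List.getLast?_eq_some_iff.1 hv
      obtain ⟨u', v', w, rfl, rfl, h⟩ := ih v₀
      exact ⟨u', v', w ++ [a], by simp, by simp, h⟩
    · refine ⟨u ++ [a], v, [], by simp, by simp, ?_⟩
      intro b hb
      simp only [List.getLast?_concat, Option.some.injEq] at hb
      exact hb ▸ hv

theorem fgw_mul_inv_eq_mk {A : Type*} (u v : List A) :
    fgw u * (fgw v)⁻¹ =
      FreeGroup.mk ((u.map fun a => (a, true)) ++ (v.reverse.map fun a => (a, false))) := by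
  rw [fgw_eq_mk, fgw_eq_mk, FreeGroup.inv_mk, FreeGroup.mul_mk]
  simp [FreeGroup.invRev, Function.comp_def]

theorem NoCommonLast.isReduced {A : Type*} {u v : List A} (h : NoCommonLast u v) :
    FreeGroup.IsReduced
      ((u.map fun a => (a, true)) ++ (v.reverse.map fun a => (a, false))) := by
  have key (b : Bool) (w : List A) : FreeGroup.IsReduced (w.map fun a => (a, b)) := by
    rw [FreeGroup.IsReduced, List.isChain_map]
    simp [List.isChain_iff_getElem]
  refine List.isChain_append.2 ⟨key _ _, key _ _, ?_⟩
  rintro ⟨a, s⟩ ha ⟨b, t⟩ hb hab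
  simp only [List.getLast?_map, List.head?_map, List.head?_reverse, Option.mem_def,
    Option.map_eq_some_iff, Prod.mk.injEq] at ha hb
  obtain ⟨_, ha, rfl, _⟩ := ha
  obtain ⟨_, hb, rfl, _⟩ := hb
  exact absurd (by rw [hb]; exact congrArg some hab.symm) (h _ ha)

theorem NoCommonLast.eq_of_fgw_mul_inv_eq {A : Type*} {u v u' v' : List A}
    (h : NoCommonLast u v) (h' : NoCommonLast u' v')
    (heq : fgw u * (fgw v)⁻¹ = fgw u' * (fgw v')⁻¹) : u = u' ∧ v = v' := by
  classical
  rw [fgw_mul_inv_eq_mk, fgw_mul_inv_eq_mk] at heq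
  have e := congrArg FreeGroup.toWord heq
  rw [FreeGroup.toWord_mk, FreeGroup.toWord_mk, h.isReduced.reduce_eq,
    h'.isReduced.reduce_eq] at e
  have e₁ := congrArg (fun l => (l.filter fun p => p.2).map Prod.fst) e
  have e₂ := congrArg (fun l => (l.filter fun p => !p.2).map Prod.fst) e
  simp [List.filter_map, Function.comp_def] at e₁ e₂
  exact ⟨e₁, e₂⟩

theorem NoCommonLast.exists_append_of_fgw_mul_inv_eq {A : Type*} {u v u' v' : List A}
    (h : NoCommonLast u v) (heq : fgw u * (fgw v)⁻¹ = fgw u' * (fgw v')⁻¹) :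
    ∃ w, u' = u ++ w ∧ v' = v ++ w := by
  obtain ⟨u₁, v₁, w, rfl, rfl, h₁⟩ := exists_append_noCommonLast u' v'
  obtain ⟨rfl, rfl⟩ := h.eq_of_fgw_mul_inv_eq h₁ (by rw [heq, fgw_append, fgw_append]; group)
  exact ⟨w, rfl, rfl⟩

/-- Lemma 5.11 (biscoito): if `βα⁻¹` is in reduced form, `βα⁻¹ ∈ ξ_x` and `βα⁻¹g ∈ ξ_x`
for some `x` in the subshift, then `g` is simple with respect to the subshift, i.e.
`g = μν⁻¹` with `μ, ν` in the language. -/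
theorem stmt_11 {A : Type*} [Nonempty A] (Forb : Set (List A)) (α β : List A) (g : FreeGroup A)
    (x : ℕ → A)
    (hα : α ∈ lang (subshift Forb)) (hβ : β ∈ lang (subshift Forb))
    (hx : x ∈ subshift Forb)
    (hred : NoCommonLast β α)
    (h1 : fgw β * (fgw α)⁻¹ ∈ xiSet (subshift Forb) x)
    (h2 : fgw β * (fgw α)⁻¹ * g ∈ xiSet (subshift Forb) x) :
    ∃ μ ∈ lang (subshift Forb), ∃ ν ∈ lang (subshift Forb), g = fgw μ * (fgw ν)⁻¹ := by
  obtain ⟨α', -, β', -, hαβ, y, rfl, -, hαy⟩ := h1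
  obtain ⟨ε, hε, δ, -, hg, w, hxw, -, hεw⟩ := h2
  obtain ⟨γ, rfl, rfl⟩ := hred.exists_append_of_fgw_mul_inv_eq hαβ
  rw [wcat_append] at hxw hαy
  have hg' : g = fgw α * (fgw β)⁻¹ * (fgw δ * (fgw ε)⁻¹) := by rw [← hg]; group
  rcases le_total β.length δ.length with hl | hl
  · obtain ⟨κ, rfl, hκ⟩ := exists_append_of_wcat_eq hxw hl
    rw [hκ, ← wcat_append] at hαy
    refine ⟨α ++ κ, mem_lang_of_wcat_mem hαy, ε, hε, ?_⟩
    rw [hg', fgw_append, fgw_append]; group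
  · obtain ⟨κ, rfl, hκ⟩ := exists_append_of_wcat_eq hxw.symm hl
    rw [hκ, ← wcat_append] at hεw
    refine ⟨α, hα, ε ++ κ, mem_lang_of_wcat_mem hεw, ?_⟩
    rw [hg', fgw_append, fgw_append]; group
end
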